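/- arXiv:1309.2715 — 2 statements merged into one kernel-verified Lean document; each statement's English description precedes it below -/
import Mathlib

section
/- For every multi-index α = (α₁,…,α_N) ∈ ℕᴺ, the product H_α(v) := ∏_{i=1}^N H_{α_i}(v_i) satisfies Σ_{j=1}^N (I−T_j)[H_α] = σ_α H_α with eigenvalue σ_α = Σ_{i=1}^N (1 − s_{α_i}), where s_n = (2π)⁻¹∫₀^{2π} cosⁿ θ dθ. -/
open MeasureTheory Real
open scoped BigOperators

noncomputable section

/-- standard Gaussian density on ℝ -/
def g (v : ℝ) : ℝ := (Real.sqrt (2 * Real.pi))⁻¹ * Real.exp (-v ^ 2 / 2)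

/-- product Gaussian density on ℝᴺ -/
def gam (N : ℕ) (v : Fin N → ℝ) : ℝ := ∏ i, g (v i)

/-- the Gaussian measure γ(v)dv on ℝᴺ -/
def gmeas (N : ℕ) : Measure (Fin N → ℝ) :=
  volume.withDensity (fun v => ENNReal.ofReal (gam N v))

/-- average over θ ∈ [0, 2π] -/
def avg (F : ℝ → ℝ) : ℝ := (2 * Real.pi)⁻¹ * ∫ θ in (0:ℝ)..(2 * Real.pi), F θ

/-- v with coordinates i,j rotated by angle θ -/
def rot (N : ℕ) (v : Fin N → ℝ) (i j : Fin N) (θ : ℝ) : Fin N → ℝ :=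
  Function.update (Function.update v i (v i * Real.cos θ + v j * Real.sin θ)) j
    (-(v i) * Real.sin θ + v j * Real.cos θ)

/-- the Kac collision operator Q -/
def Qop (N : ℕ) (h : (Fin N → ℝ) → ℝ) (v : Fin N → ℝ) : ℝ :=
  ((N.choose 2 : ℝ))⁻¹ * ∑ i : Fin N, ∑ j : Fin N,
    if i < j then avg (fun θ => h (rot N v i j θ)) else 0

/-- 𝓛_K = N (I - Q) -/
def LK (N : ℕ) (h : (Fin N → ℝ) → ℝ) (v : Fin N → ℝ) : ℝ :=
  (N : ℝ) * (h v - Qop N h v)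

/-- v with j-th coordinate replaced by v_j cos θ + w sin θ -/
def rotw (N : ℕ) (v : Fin N → ℝ) (j : Fin N) (θ w : ℝ) : Fin N → ℝ :=
  Function.update v j (v j * Real.cos θ + w * Real.sin θ)

/-- the thermostat operator T_j -/
def Tj (N : ℕ) (j : Fin N) (h : (Fin N → ℝ) → ℝ) (v : Fin N → ℝ) : ℝ :=
  ∫ w : ℝ, g w * avg (fun θ => h (rotw N v j θ w))

/-- 𝓛_T = Σ_j (I - T_j) -/
def LTherm (N : ℕ) (h : (Fin N → ℝ) → ℝ) (v : Fin N → ℝ) : ℝ :=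
  ∑ j : Fin N, (h v - Tj N j h v)

/-- inner product on L²(ℝᴺ, γ dv) -/
def iprod (N : ℕ) (h₁ h₂ : (Fin N → ℝ) → ℝ) : ℝ :=
  ∫ v : Fin N → ℝ, h₁ v * h₂ v * gam N v

/-- probabilist's Hermite polynomial H_α(v) = (−1)ᵅ e^{v²/2} (d/dv)ᵅ e^{−v²/2} -/
def Herm (n : ℕ) (v : ℝ) : ℝ :=
  (-1 : ℝ) ^ n * Real.exp (v ^ 2 / 2) * iteratedDeriv n (fun x => Real.exp (-x ^ 2 / 2)) v

/-- s_n = (2π)⁻¹ ∫₀^{2π} cosⁿ θ dθ -/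
def sCoef (n : ℕ) : ℝ := avg (fun θ => Real.cos θ ^ n)

/-- the master-equation thermostat operator R_j acting on densities -/
def Rop (N : ℕ) (j : Fin N) (f : (Fin N → ℝ) → ℝ) (v : Fin N → ℝ) : ℝ :=
  ∫ w : ℝ, avg (fun θ =>
    g (-(v j) * Real.sin θ + w * Real.cos θ) * f (rotw N v j θ w))

/-- relative entropy S(f|γ) -/
def relEnt (N : ℕ) (f : (Fin N → ℝ) → ℝ) : ℝ :=
  ∫ v : Fin N → ℝ, f v * Real.log (f v / gam N v)

open Polynomial in
/-- The derivative of a Hermite polynomial is a multiple of the previous one. -/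
theorem derivative_hermite_succ (n : ℕ) :
    derivative (hermite (n + 1)) = ((n : ℤ[X]) + 1) * hermite n := by
  induction n with
  | zero => simp
  | succ n ih =>
    have h := hermite_succ n
    rw [hermite_succ (n + 1), derivative_sub, derivative_mul, derivative_X, ih, derivative_mul]
    simp only [derivative_add, derivative_natCast, derivative_one]
    rw [h]
    push_cast
    ring

open Polynomial in
/-- The real-valued Hermite function `Herm n` is evaluation of Mathlib's `hermite n`. -/
theorem Herm_eq_eval (n : ℕ) (v : ℝ) :
    Herm n v = ((hermite n).map (Int.castRingHom ℝ)).eval v := by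
  have h := hermite_eq_deriv_gaussian' n v
  rw [aeval_def, ← eval_map, algebraMap_int_eq] at h
  rw [h, Herm, iteratedDeriv_eq_iterate]
  simp only [neg_div]
  ring

theorem integrable_g_mul_pow (n : ℕ) : Integrable (fun w : ℝ => g w * w ^ n) := by
  have h := integrable_rpow_mul_exp_neg_mul_sq (b := 1 / 2) (by norm_num)
    (s := (n : ℝ)) (by have : (0 : ℝ) ≤ n := n.cast_nonneg
                       linarith)
  refine (h.const_mul (Real.sqrt (2 * Real.pi))⁻¹).congr (.of_forall fun w => ?_)
  simp only [g, Real.rpow_natCast]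
  rw [show -(1 / 2 : ℝ) * w ^ 2 = -w ^ 2 / 2 by ring]
  ring

open Polynomial in
theorem integrable_g_mul_eval (p : ℝ[X]) : Integrable (fun w : ℝ => g w * p.eval w) := by
  induction p using Polynomial.induction_on' with
  | add p q hp hq => simpa only [eval_add, mul_add] using! hp.add hq
  | monomial n a =>
    refine ((integrable_g_mul_pow n).const_mul a).congr (.of_forall fun w => ?_)
    simp only [eval_monomial]
    ring

theorem integral_g : ∫ w : ℝ, g w = 1 := by
  have h := integral_gaussian (1 / 2)
  simp only [g, integral_const_mul]
  rw [show (fun w : ℝ => Real.exp (-w ^ 2 / 2)) = fun w => Real.exp (-(1 / 2) * w ^ 2) by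
    ext w; congr 1; ring, h, show Real.pi / (1 / 2) = 2 * Real.pi by ring]
  exact inv_mul_cancel₀ (by positivity)

theorem hasDerivAt_g (w : ℝ) : HasDerivAt g (-w * g w) w := by
  have h : HasDerivAt (fun x : ℝ => -x ^ 2 / 2) (-w) w := by
    convert! ((hasDerivAt_pow 2 w).neg.div_const 2) using 1
    push_cast
    ring
  convert! h.exp.const_mul (Real.sqrt (2 * Real.pi))⁻¹ using 1
  simp only [g]
  ring

open Polynomial in
/-- Gaussian integration by parts for polynomials. -/
theorem integral_g_mul_id_mul_eval (p : ℝ[X]) :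
    ∫ w : ℝ, g w * (w * p.eval w) = ∫ w : ℝ, g w * (derivative p).eval w := by
  have hX : Integrable (fun w : ℝ => g w * (w * p.eval w)) := by
    have h := integrable_g_mul_eval (X * p)
    simpa only [eval_mul, eval_X] using h
  have hp' := integrable_g_mul_eval (derivative p)
  have h := integral_eq_zero_of_hasDerivAt_of_integrable
    (f := fun w : ℝ => g w * p.eval w)
    (f' := fun w => g w * (derivative p).eval w - g w * (w * p.eval w))
    (fun w => by
      convert! (hasDerivAt_g w).mul (p.hasDerivAt w) using 1
      ring)
    (hp'.sub hX) (integrable_g_mul_eval p)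
  rw [integral_sub hp' hX] at h
  linarith

open Polynomial in
/-- Hermite polynomials are eigenfunctions of the Mehler (Ornstein–Uhlenbeck) semigroup. -/
theorem integral_g_mul_Herm_rotation {c s : ℝ} (hcs : c ^ 2 + s ^ 2 = 1) (v : ℝ) (n : ℕ) :
    ∫ w : ℝ, g w * Herm n (v * c + w * s) = c ^ n * Herm n v := by
  simp only [Herm_eq_eval]
  set L : ℝ[X] := C (v * c) + X * C s with hL
  set he : ℕ → ℝ[X] := fun n => (hermite n).map (Int.castRingHom ℝ) with hhe
  have hint : ∀ p : ℝ[X], Integrable (fun w : ℝ => g w * p.eval (v * c + w * s)) := fun p => by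
    simpa only [hL, eval_comp, eval_add, eval_mul, eval_C, eval_X] using
      integrable_g_mul_eval (p.comp L)
  have hsucc : ∀ n, he (n + 1) = X * he n - derivative (he n) := fun n => by
    simp [hhe, hermite_succ, Polynomial.derivative_map]
  have hder : ∀ n, derivative (he (n + 1)) = C ((n : ℝ) + 1) * he n := fun n => by
    simp only [hhe, Polynomial.derivative_map, derivative_hermite_succ]
    simp
  have hstein : ∀ p : ℝ[X], ∫ w : ℝ, g w * (w * p.eval (v * c + w * s))
      = s * ∫ w : ℝ, g w * (derivative p).eval (v * c + w * s) := fun p => by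
    have h := integral_g_mul_id_mul_eval (p.comp L)
    simp only [hL, derivative_comp, eval_comp, eval_mul, eval_add, eval_C, eval_X,
      derivative_add, derivative_mul, derivative_C, derivative_X] at h
    rw [h, ← integral_const_mul]
    congr 1
    ext w
    simp
    ring
  have hrec : ∀ n, ∫ w : ℝ, g w * (he (n + 1)).eval (v * c + w * s)
      = v * c * (∫ w : ℝ, g w * (he n).eval (v * c + w * s))
        - c ^ 2 * ∫ w : ℝ, g w * (derivative (he n)).eval (v * c + w * s) := fun n => by
    have h1 := hint (he n)
    have h2 := hint (derivative (he n))
    have h3 : Integrable (fun w : ℝ => g w * (w * (he n).eval (v * c + w * s))) := by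
      have h := integrable_g_mul_eval (X * (he n).comp L)
      simpa only [hL, eval_comp, eval_add, eval_mul, eval_C, eval_X] using h
    have hs := hstein (he n)
    have e : (fun w : ℝ => g w * (he (n + 1)).eval (v * c + w * s)) = fun w =>
        (v * c * (g w * (he n).eval (v * c + w * s))
          + s * (g w * (w * (he n).eval (v * c + w * s))))
          - g w * (derivative (he n)).eval (v * c + w * s) := by
      ext w
      rw [hsucc]
      simp only [eval_sub, eval_mul, eval_X]
      ring
    have h13 : Integrable (fun w : ℝ => v * c * (g w * (he n).eval (v * c + w * s))
        + s * (g w * (w * (he n).eval (v * c + w * s)))) :=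
      (h1.const_mul _).add (h3.const_mul _)
    rw [e, integral_sub h13 h2,
      integral_add (h1.const_mul _) (h3.const_mul _), integral_const_mul, integral_const_mul, hs]
    linear_combination
      (∫ w : ℝ, g w * (derivative (he n)).eval (v * c + w * s)) * hcs
  have h0 : ∫ w : ℝ, g w * (he 0).eval (v * c + w * s) = c ^ 0 * (he 0).eval v := by
    simp [hhe, integral_g]
  change ∫ w : ℝ, g w * (he n).eval (v * c + w * s) = c ^ n * (he n).eval v
  induction n using Nat.twoStepInduction with
  | zero => exact h0
  | one =>
    rw [hrec, h0]
    simp [hhe]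
    ring
  | more n ih1 ih2 =>
    rw [hrec, ih2, hsucc (n + 1), hder]
    simp only [eval_mul, eval_sub, eval_X, eval_C]
    rw [show (fun w : ℝ => g w * (((n : ℝ) + 1) * (he n).eval (v * c + w * s)))
      = fun w => ((n : ℝ) + 1) * (g w * (he n).eval (v * c + w * s)) by ext w; ring,
      integral_const_mul, ih1]
    ring

open Polynomial in
theorem integrable_prod_g_mul_eval_rotation (p : ℝ[X]) (v a b : ℝ) :
    Integrable (fun z : ℝ × ℝ => g z.1 * p.eval (v * Real.cos z.2 + z.1 * Real.sin z.2))
      (volume.prod (volume.restrict (Set.Ioc a b))) := by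
  induction p using Polynomial.induction_on' with
  | add p q hp hq => simpa only [eval_add, mul_add] using! hp.add hq
  | monomial n r =>
    have hterm : ∀ k m l : ℕ, Integrable
        (fun z : ℝ × ℝ => g z.1 * z.1 ^ k * (Real.cos z.2 ^ m * Real.sin z.2 ^ l))
        (volume.prod (volume.restrict (Set.Ioc a b))) := fun k m l =>
      (integrable_g_mul_pow k).mul_prod
        (g := fun θ : ℝ => Real.cos θ ^ m * Real.sin θ ^ l)
        (Continuous.integrableOn_Ioc (by fun_prop))
    refine (integrable_finsetSum (Finset.range (n + 1)) fun m _ =>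
      (hterm (n - m) m (n - m)).const_mul (r * v ^ m * (n.choose m : ℝ))).congr
      (.of_forall fun z => ?_)
    simp only [eval_monomial, add_pow, Finset.mul_sum]
    refine Finset.sum_congr rfl fun m _ => ?_
    ring

/-- The one-dimensional thermostat operator acts on `Herm n` by multiplication by `sCoef n`. -/
theorem integral_g_mul_avg_Herm (n : ℕ) (v : ℝ) :
    ∫ w : ℝ, g w * avg (fun θ => Herm n (v * Real.cos θ + w * Real.sin θ))
      = sCoef n * Herm n v := by
  have hpi : (0 : ℝ) ≤ 2 * Real.pi := by positivity
  have hint : Integrable (Function.uncurry fun w θ : ℝ =>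
      g w * Herm n (v * Real.cos θ + w * Real.sin θ))
      (volume.prod (volume.restrict (Set.Ioc 0 (2 * Real.pi)))) := by
    simpa only [Function.uncurry_def, Herm_eq_eval] using
      integrable_prod_g_mul_eval_rotation _ v 0 (2 * Real.pi)
  simp only [avg, sCoef, intervalIntegral.integral_of_le hpi]
  simp only [mul_left_comm (g _), integral_const_mul]
  simp only [← integral_const_mul (g _)]
  rw [integral_integral_swap hint]
  simp only [integral_g_mul_Herm_rotation (Real.cos_sq_add_sin_sq _), integral_mul_const]
  ring

theorem Tj_prod_Herm (N : ℕ) (j : Fin N) (α : Fin N → ℕ) (v : Fin N → ℝ) :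
    Tj N j (fun u => ∏ i, Herm (α i) (u i)) v = sCoef (α j) * ∏ i, Herm (α i) (v i) := by
  have hupd : ∀ x : ℝ, ∏ i, Herm (α i) (Function.update v j x i)
      = (∏ i ∈ Finset.univ.erase j, Herm (α i) (v i)) * Herm (α j) x := fun x => by
    rw [← Finset.prod_erase_mul _ _ (Finset.mem_univ j), Function.update_self]
    congr 1
    refine Finset.prod_congr rfl fun i hi => ?_
    rw [Function.update_of_ne (Finset.ne_of_mem_erase hi)]
  simp only [Tj, rotw, hupd]
  rw [← Finset.prod_erase_mul _ _ (Finset.mem_univ j), mul_left_comm,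
    ← integral_g_mul_avg_Herm, ← integral_const_mul]
  congr 1
  ext w
  simp only [avg, intervalIntegral.integral_const_mul]
  ring

/-- products of Hermite polynomials are eigenfunctions of
𝓛_T = Σ_j (I−T_j), with eigenvalue σ_α = Σ_i (1 − s_{α_i}). -/
theorem hermite_products_eigenfunctions_of_LT (N : ℕ) (hN : 1 ≤ N)
    (α : Fin N → ℕ) (v : Fin N → ℝ) :
    LTherm N (fun u => ∏ i, Herm (α i) (u i)) v
      = (∑ i, (1 - sCoef (α i))) * ∏ i, Herm (α i) (v i) := by
  simp only [LTherm, Tj_prod_Herm, Finset.sum_mul, sub_mul, one_mul]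

end
end

section
/- Let l ≥ 1 and let α = (α₁,…,α_N) ∈ ℕᴺ with Σ_{i=1}^N α_i = l. Then: (i) Σ_{i=1}^N (1 − s_{2α_i}) ≥ 1 − s_{2l}, with equality if and only if exactly one entry of α is nonzero (and hence equal to l); (ii) if at least two entries of α are nonzero, then Σ_{i=1}^N (1 − s_{2α_i}) ≥ 1, and this value 1 is attained when two entries of α equal 1 and all other entries are 0. -/
open MeasureTheory Real
open scoped BigOperators

noncomputable section

theorem sCoef_zero : sCoef 0 = 1 := by
  simp [sCoef, avg]
  field_simp

theorem sCoef_add_two (n : ℕ) : sCoef (n + 2) = (n + 1) / (n + 2) * sCoef n := by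
  simp only [sCoef, avg, integral_cos_pow, Real.sin_two_pi, Real.sin_zero]
  ring

theorem sCoef_two_mul_pos (k : ℕ) : 0 < sCoef (2 * k) := by
  induction k with
  | zero => simp [sCoef_zero]
  | succ k ih =>
    rw [mul_add, mul_one, sCoef_add_two]
    positivity

theorem sCoef_two : sCoef 2 = 1 / 2 := by
  have h := sCoef_add_two 0
  norm_num [sCoef_zero] at h
  rw [h]

theorem sCoef_two_mul_succ_le (k : ℕ) : sCoef (2 * (k + 1)) ≤ sCoef (2 * k) := by
  rw [mul_add, mul_one, sCoef_add_two]
  refine mul_le_of_le_one_left (sCoef_two_mul_pos k).le ?_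
  rw [div_le_one (by positivity)]
  linarith

theorem sCoef_two_mul_antitone : Antitone fun k => sCoef (2 * k) :=
  antitone_nat_of_succ_le sCoef_two_mul_succ_le

theorem sCoef_two_mul_le_one (k : ℕ) : sCoef (2 * k) ≤ 1 := by
  simpa [sCoef_zero] using sCoef_two_mul_antitone (Nat.zero_le k)

theorem sCoef_two_mul_le_half {k : ℕ} (hk : k ≠ 0) : sCoef (2 * k) ≤ 1 / 2 := by
  simpa [sCoef_two] using sCoef_two_mul_antitone (Nat.one_le_iff_ne_zero.mpr hk)

theorem one_le_sum_one_sub_sCoef {ι : Type*} [Fintype ι] (α : ι → ℕ) {i j : ι}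
    (hij : i ≠ j) (hi : α i ≠ 0) (hj : α j ≠ 0) :
    1 ≤ ∑ k, (1 - sCoef (2 * α k)) := by
  classical
  have h : ∑ k ∈ {i, j}, (1 - sCoef (2 * α k)) ≤ ∑ k, (1 - sCoef (2 * α k)) :=
    Finset.sum_le_sum_of_subset_of_nonneg (Finset.subset_univ _)
      fun k _ _ => sub_nonneg.mpr (sCoef_two_mul_le_one (α k))
  rw [Finset.sum_pair hij] at h
  linarith [sCoef_two_mul_le_half hi, sCoef_two_mul_le_half hj]

theorem sum_one_sub_sCoef_of_existsUnique {ι : Type*} [Fintype ι] (α : ι → ℕ)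
    (h : ∃! i, α i ≠ 0) :
    ∑ i, (1 - sCoef (2 * α i)) = 1 - sCoef (2 * ∑ i, α i) := by
  obtain ⟨i, -, hi⟩ := h
  have hz : ∀ k, k ≠ i → α k = 0 := fun k hk => by
    by_contra h
    exact hk (hi k h)
  rw [Fintype.sum_eq_single i fun k hk => by simp [hz k hk, sCoef_zero],
    Fintype.sum_eq_single i hz]

/-- minimization of σ_{2α} = Σ_i (1 − s_{2α_i}) over multi-indices with
|α| = l: the minimum is 1 − s_{2l}, attained exactly when one entry is nonzero;
over α with at least two nonzero entries the sum is ≥ 1, with value 1 attained when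
two entries equal 1 and the rest vanish. -/
theorem sigma_minimization (N l : ℕ) (hl : 1 ≤ l) (α : Fin N → ℕ)
    (hsum : ∑ i, α i = l) :
    (1 - sCoef (2 * l) ≤ ∑ i, (1 - sCoef (2 * α i))
      ∧ ((∑ i, (1 - sCoef (2 * α i))) = 1 - sCoef (2 * l) ↔ ∃! i, α i ≠ 0))
    ∧ ((∃ i j : Fin N, i ≠ j ∧ α i ≠ 0 ∧ α j ≠ 0) →
        1 ≤ ∑ i, (1 - sCoef (2 * α i)))
    ∧ ((∃ i j : Fin N, i ≠ j ∧ α i = 1 ∧ α j = 1 ∧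
          ∀ k, k ≠ i → k ≠ j → α k = 0) →
        (∑ i, (1 - sCoef (2 * α i))) = 1) := by
  have hpos := sCoef_two_mul_pos l
  have hex : ∃ i, α i ≠ 0 := by
    by_contra! h
    simp [h] at hsum
    omega
  have hcases : (∃! i, α i ≠ 0) ∨ ∃ i j, i ≠ j ∧ α i ≠ 0 ∧ α j ≠ 0 := by
    obtain ⟨i, hi⟩ := hex
    by_cases h : ∃ j, i ≠ j ∧ α j ≠ 0
    · obtain ⟨j, hij, hj⟩ := h
      exact Or.inr ⟨i, j, hij, hi, hj⟩
    · push Not at h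
      refine Or.inl ⟨i, hi, fun j hj => ?_⟩
      by_contra hji
      exact hj (h j (Ne.symm hji))
  have huniq : (∃! i, α i ≠ 0) → ∑ i, (1 - sCoef (2 * α i)) = 1 - sCoef (2 * l) := by
    intro h
    rw [sum_one_sub_sCoef_of_existsUnique α h, hsum]
  have htwo : (∃ i j, i ≠ j ∧ α i ≠ 0 ∧ α j ≠ 0) → 1 ≤ ∑ i, (1 - sCoef (2 * α i)) := by
    rintro ⟨i, j, hij, hi, hj⟩
    exact one_le_sum_one_sub_sCoef α hij hi hj
  refine ⟨⟨?_, ?_, huniq⟩, htwo, ?_⟩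
  · rcases hcases with h | h
    · exact (huniq h).ge
    · linarith [htwo h]
  · intro heq
    refine hcases.resolve_right fun h => ?_
    linarith [htwo h]
  · rintro ⟨i, j, hij, hi, hj, hk⟩
    rw [Fintype.sum_eq_add i j hij fun k hk' => by
      simp [hk k hk'.1 hk'.2, sCoef_zero], hi, hj, mul_one, sCoef_two]
    norm_num

end
end
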